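/- arXiv:1304.6683 — 2 statements merged into one kernel-verified Lean document; each statement's English description precedes it below -/
import Mathlib

section
/- Let (a_l)_{l ≥ 2} be a sequence of real numbers with Σ_{l=2}^∞ l! · a_l² < ∞. Then for every ν ∈ (1/2, 1) the double series λ(ν) = Σ_{l=2}^∞ l! · a_l² · (1 + 2 Σ_{j=1}^∞ ρ_ν(j)^l) converges, and the function ν ↦ λ(ν) is continuous on (1/2, 1). -/
/-- The autocorrelation function of fractional Gaussian noise with Hurst parameter `ν - 1/2`:
`ρ_ν(j) = (1/2)((j+1)^{2ν-1} - 2 j^{2ν-1} + (j-1)^{2ν-1})`, using real powers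
(note `(0:ℝ) ^ (2ν-1) = 0` for `ν ∈ (1/2,1)` since the exponent is nonzero). -/
noncomputable def rho (ν : ℝ) (j : ℕ) : ℝ :=
  (1/2) * (((j:ℝ) + 1) ^ (2*ν - 1) - 2 * (j:ℝ) ^ (2*ν - 1) + ((j:ℝ) - 1) ^ (2*ν - 1))

/-- The second difference of `x ↦ x ^ s` is nonpositive and at most `2 / j` in absolute value,
uniformly in `s ∈ (0, 1)`. -/
lemma abs_rho_succ_le {ν : ℝ} (hν : ν ∈ Set.Ioo (1/2 : ℝ) 1) (j : ℕ) :
    |rho ν (j+1)| ≤ 1 / ((j:ℝ) + 1) := by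
  obtain ⟨h1, h2⟩ := hν
  obtain ⟨s, hs⟩ : ∃ s, s = 2 * ν - 1 := ⟨_, rfl⟩
  obtain ⟨x, hx⟩ : ∃ x : ℝ, x = (j:ℝ) + 1 := ⟨_, rfl⟩
  have hs0 : 0 < s := by linarith
  have hs1 : s < 1 := by linarith
  have hx1 : 1 ≤ x := by rw [hx]; linarith [Nat.cast_nonneg (α := ℝ) j]
  have hx0 : 0 < x := by linarith
  have hrho : rho ν (j+1) = (1/2) * ((x + 1) ^ s - 2 * x ^ s + (x - 1) ^ s) := by
    simp only [rho, hs, hx]; push_cast; rfl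
  rw [hrho, ← hx]
  have hconc : (x + 1) ^ s + (x - 1) ^ s ≤ 2 * x ^ s := by
    have h := (Real.concaveOn_rpow hs0.le hs1.le).2
      (show x + 1 ∈ Set.Ici (0:ℝ) from Set.mem_Ici.2 (by linarith))
      (show x - 1 ∈ Set.Ici (0:ℝ) from Set.mem_Ici.2 (by linarith))
      (show (0:ℝ) ≤ 1/2 by norm_num) (show (0:ℝ) ≤ 1/2 by norm_num) (by norm_num)
    simp only [smul_eq_mul] at h
    rw [show 1/2 * (x + 1) + 1/2 * (x - 1) = x by ring] at h
    linarith
  have hsq {y : ℝ} (hy : 0 ≤ y) : (y ^ (s/2)) ^ 2 = y ^ s := by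
    rw [← Real.rpow_mul_natCast hy]; congr 1; push_cast; ring
  have hlow : 2 * x ^ s - 2 / x ≤ (x + 1) ^ s + (x - 1) ^ s := by
    have hamgm := two_mul_le_add_sq ((x + 1) ^ (s/2)) ((x - 1) ^ (s/2))
    rw [hsq (by linarith), hsq (by linarith), mul_assoc,
      ← Real.mul_rpow (by linarith) (by linarith)] at hamgm
    have hx2 : 1 / x ^ 2 ≤ 1 := by
      rw [div_le_one (by positivity)]; nlinarith
    have hfac : ((x + 1) * (x - 1)) ^ (s/2) = x ^ s * (1 - 1 / x ^ 2) ^ (s/2) := by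
      rw [show (x + 1) * (x - 1) = x ^ 2 * (1 - 1 / x ^ 2) by field_simp; ring,
        Real.mul_rpow (by positivity) (by linarith), ← hsq hx0.le,
        ← Real.rpow_natCast_mul hx0.le, ← Real.rpow_mul_natCast hx0.le]
      congr 2; ring
    have hpow : 1 - 1 / x ^ 2 ≤ (1 - 1 / x ^ 2) ^ (s/2) :=
      Real.self_le_rpow_of_le_one (by linarith) (by linarith [show 0 < 1 / x ^ 2 by positivity])
        (by linarith)
    have hxs : x ^ s ≤ x := Real.rpow_le_self_of_one_le hx1 hs1.le
    have hprod : x ^ s * (1 - 1 / x ^ 2) ≤ x ^ s * (1 - 1 / x ^ 2) ^ (s/2) := by gcongr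
    have hrem : x ^ s * (1 / x ^ 2) ≤ 1 / x := by
      calc x ^ s * (1 / x ^ 2) ≤ x * (1 / x ^ 2) := by gcongr
        _ = 1 / x := by field_simp
    rw [hfac] at hamgm
    have : 2 / x = 2 * (1 / x) := by ring
    linarith
  have : 2 / x = 2 * (1 / x) := by ring
  have : 0 < 1 / x := by positivity
  rw [abs_le]
  constructor <;> linarith

lemma norm_rho_succ_pow_le {ν : ℝ} (hν : ν ∈ Set.Ioo (1/2 : ℝ) 1) (l j : ℕ) :
    ‖rho ν (j+1) ^ (l+2)‖ ≤ 1 / ((j:ℝ) + 1) ^ 2 := by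
  have h := abs_rho_succ_le hν j
  have h1 : 1 / ((j:ℝ) + 1) ≤ 1 := by
    rw [div_le_one (by positivity)]; linarith [Nat.cast_nonneg (α := ℝ) j]
  rw [norm_pow, Real.norm_eq_abs]
  calc |rho ν (j+1)| ^ (l+2) ≤ |rho ν (j+1)| ^ 2 :=
        pow_le_pow_of_le_one (abs_nonneg _) (h.trans h1) (by lia)
    _ ≤ (1 / ((j:ℝ) + 1)) ^ 2 := by gcongr
    _ = 1 / ((j:ℝ) + 1) ^ 2 := by rw [div_pow, one_pow]

lemma summable_one_div_succ_sq : Summable (fun j : ℕ => 1 / ((j:ℝ) + 1) ^ 2) := by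
  simpa using (summable_nat_add_iff 1).2 (Real.summable_one_div_nat_pow.2 one_lt_two)

lemma continuousOn_rho (j : ℕ) :
    ContinuousOn (fun ν => rho ν j) (Set.Ioo (1/2 : ℝ) 1) := by
  have hpow (c : ℝ) : ContinuousOn (fun ν : ℝ => c ^ (2*ν - 1)) (Set.Ioo (1/2 : ℝ) 1) :=
    ContinuousOn.rpow (by fun_prop) (by fun_prop)
      fun ν hν => Or.inr (by linarith [hν.1])
  exact continuousOn_const.mul
    (((hpow _).sub (continuousOn_const.mul (hpow _))).add (hpow _))

lemma norm_weighted_tsum_rho_le {ν : ℝ} (hν : ν ∈ Set.Ioo (1/2 : ℝ) 1) {w : ℝ} (hw : 0 ≤ w)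
    (l : ℕ) :
    ‖w * (1 + 2 * ∑' j : ℕ, rho ν (j+1) ^ (l+2))‖ ≤
      w * (1 + 2 * ∑' j : ℕ, 1 / ((j:ℝ) + 1) ^ 2) := by
  have h := tsum_of_norm_bounded summable_one_div_succ_sq.hasSum (norm_rho_succ_pow_le hν l)
  rw [norm_mul, Real.norm_of_nonneg hw]
  gcongr
  refine (norm_add_le _ _).trans ?_
  rw [norm_one, norm_mul, Real.norm_ofNat]
  gcongr

/-- `λ(ν) = Σ_{l=2}^∞ l! a_l² (1 + 2 Σ_{j=1}^∞ ρ_ν(j)^l)`, where the outer sum over `l ≥ 2` is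
written as a sum over `l : ℕ` with index shifted by `2`. -/
theorem lambda_continuous (a : ℕ → ℝ)
    (ha : Summable (fun l : ℕ => ((l+2).factorial : ℝ) * a (l+2) ^ 2)) :
    (∀ ν ∈ Set.Ioo (1/2 : ℝ) 1,
      (∀ l : ℕ, Summable (fun j : ℕ => rho ν (j+1) ^ (l+2))) ∧
        Summable (fun l : ℕ =>
          ((l+2).factorial : ℝ) * a (l+2) ^ 2 * (1 + 2 * ∑' j : ℕ, rho ν (j+1) ^ (l+2)))) ∧
      ContinuousOn
        (fun ν : ℝ => ∑' l : ℕ,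
          ((l+2).factorial : ℝ) * a (l+2) ^ 2 * (1 + 2 * ∑' j : ℕ, rho ν (j+1) ^ (l+2)))
        (Set.Ioo (1/2) 1) := by
  have hw (l : ℕ) : 0 ≤ ((l+2).factorial : ℝ) * a (l+2) ^ 2 := by positivity
  have hsum := ha.mul_right (1 + 2 * ∑' j : ℕ, 1 / ((j:ℝ) + 1) ^ 2)
  refine ⟨fun ν hν => ⟨fun l => ?_, ?_⟩, ?_⟩
  · exact summable_one_div_succ_sq.of_norm_bounded (norm_rho_succ_pow_le hν l)
  · exact hsum.of_norm_bounded fun l => norm_weighted_tsum_rho_le hν (hw l) l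
  · refine continuousOn_tsum (fun l => ?_) hsum
      fun l ν hν => norm_weighted_tsum_rho_le hν (hw l) l
    have hinner : ContinuousOn (fun ν => ∑' j : ℕ, rho ν (j+1) ^ (l+2)) (Set.Ioo (1/2 : ℝ) 1) :=
      continuousOn_tsum (fun j => (continuousOn_rho (j+1)).pow (l+2)) summable_one_div_succ_sq
        fun j ν hν => norm_rho_succ_pow_le hν l j
    exact continuousOn_const.mul (continuousOn_const.add (continuousOn_const.mul hinner))
end

section
/- Let T > 0 and set s* = −max{(η−1)/ρ, 1}. Let a : ℝ → ℝ be measurable and such that M = sup_{s ∈ [s*, T]} |a(s)| < ∞, such that for every u ∈ [0, T] the function s ↦ q(u − s)·a(s) is Lebesgue integrable on (−∞, u), and such that A* = sup_{0 ≤ u ≤ T} ∫_{−∞}^u q(u − s)·|a(s)| ds < ∞. Define A(t) = ∫_{−∞}^t q(t − s)·a(s) ds for t ∈ [0, T]. Then for every p ≥ 1 there exists a constant K > 0 such that for every δ ∈ (0, 1), Σ_{j=1}^{⌊T/δ⌋} |A(jδ) − A((j−1)δ)|^p ≤ K · δ^{p·min{η,1} − 1}; that is, the p-th order realised power variation of A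 with lag δ is O(δ^{p·min{η,1} − 1}). -/
open MeasureTheory

/-- The gamma kernel `q(t) = c t^{η-1} e^{-ρ t}`, using real powers. -/
noncomputable def gammaKernel (c η ρ t : ℝ) : ℝ := c * t ^ (η - 1) * Real.exp (-ρ * t)

/-- The skewness term `A(t) = ∫_{-∞}^t q(t-s) a(s) ds` of a Brownian semistationary process,
with a gamma kernel `q`. -/
noncomputable def skewTerm (c η ρ : ℝ) (a : ℝ → ℝ) (t : ℝ) : ℝ :=
  ∫ s in Set.Iio t, gammaKernel c η ρ (t - s) * a s

theorem Real.abs_exp_sub_one_le_abs_mul_exp_abs (x : ℝ) :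
    |Real.exp x - 1| ≤ |x| * Real.exp |x| := by
  rcases le_total 0 x with hx | hx
  · rw [abs_of_nonneg hx, abs_of_nonneg (by linarith [Real.add_one_le_exp x])]
    have h := mul_le_mul_of_nonneg_left (Real.add_one_le_exp (-x)) (Real.exp_pos x).le
    rw [← Real.exp_add, add_neg_cancel, Real.exp_zero] at h
    linarith
  · rw [abs_of_nonpos hx, abs_of_nonpos (by linarith [Real.exp_le_one_iff.2 hx])]
    nlinarith [Real.add_one_le_exp x, Real.one_le_exp (neg_nonneg.2 hx)]

theorem Real.abs_mul_log_one_add_div_sub_le (α ρ : ℝ) (hρ : 0 ≤ ρ) {t δ : ℝ} (ht : 1 ≤ t)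
    (hδ : 0 ≤ δ) : |α * Real.log (1 + δ / t) - ρ * δ| ≤ (|α| + ρ) * δ := by
  have ht0 : 0 < t := by linarith
  have hdt : 0 ≤ δ / t := by positivity
  have hlog0 : 0 ≤ Real.log (1 + δ / t) := Real.log_nonneg (by linarith)
  have hlog : Real.log (1 + δ / t) ≤ δ := by
    have h1 := Real.log_le_sub_one_of_pos (show 0 < 1 + δ / t by linarith)
    have h2 : δ / t ≤ δ := div_le_self hδ ht
    linarith
  calc |α * Real.log (1 + δ / t) - ρ * δ|
      ≤ |α * Real.log (1 + δ / t)| + |ρ * δ| := abs_sub _ _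
    _ = |α| * Real.log (1 + δ / t) + ρ * δ := by
        rw [abs_mul, abs_of_nonneg hlog0, abs_of_nonneg (mul_nonneg hρ hδ)]
    _ ≤ (|α| + ρ) * δ := by nlinarith [abs_nonneg α]

theorem gammaKernel_nonneg {c t : ℝ} (η ρ : ℝ) (hc : 0 ≤ c) (ht : 0 ≤ t) :
    0 ≤ gammaKernel c η ρ t := by
  unfold gammaKernel; positivity

theorem abs_gammaKernel_add_sub_le_of_one_le {c ρ t δ : ℝ} (η : ℝ) (hc : 0 ≤ c) (hρ : 0 ≤ ρ)
    (ht : 1 ≤ t) (hδ : 0 ≤ δ) (hδ1 : δ ≤ 1) :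
    |gammaKernel c η ρ (t + δ) - gammaKernel c η ρ t| ≤
      ((|η - 1| + ρ) * Real.exp (|η - 1| + ρ)) * δ * gammaKernel c η ρ t := by
  have ht0 : 0 < t := by linarith
  have hdt : 0 < 1 + δ / t := by positivity
  set x := (η - 1) * Real.log (1 + δ / t) - ρ * δ with hx
  have hxB : |x| ≤ (|η - 1| + ρ) * δ := Real.abs_mul_log_one_add_div_sub_le _ _ hρ ht hδ
  have hB : 0 ≤ |η - 1| + ρ := by positivity
  have hq : gammaKernel c η ρ (t + δ) = gammaKernel c η ρ t * Real.exp x := by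
    have h1 : t + δ = t * (1 + δ / t) := by field_simp
    have h2 : Real.exp (-ρ * (t + δ)) = Real.exp (-ρ * t) * Real.exp (-(ρ * δ)) := by
      rw [← Real.exp_add]; congr 1; ring
    have h3 : Real.exp x = (1 + δ / t) ^ (η - 1) * Real.exp (-(ρ * δ)) := by
      rw [Real.rpow_def_of_pos hdt, ← Real.exp_add, hx]; congr 1; ring
    unfold gammaKernel
    rw [h2, h3, h1, Real.mul_rpow ht0.le hdt.le]; ring
  have hq0 := gammaKernel_nonneg η ρ hc ht0.le
  have hfac : gammaKernel c η ρ (t + δ) - gammaKernel c η ρ t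
      = gammaKernel c η ρ t * (Real.exp x - 1) := by rw [hq]; ring
  rw [hfac, abs_mul, abs_of_nonneg hq0, mul_comm]
  refine mul_le_mul_of_nonneg_right ?_ hq0
  calc |Real.exp x - 1| ≤ |x| * Real.exp |x| := Real.abs_exp_sub_one_le_abs_mul_exp_abs x
    _ ≤ ((|η - 1| + ρ) * δ) * Real.exp (|η - 1| + ρ) := by
        gcongr
        exact hxB.trans (mul_le_of_le_one_right hB hδ1)
    _ = _ := by ring

theorem abs_gammaKernel_add_sub_le {c ρ t δ : ℝ} (η : ℝ) (hc : 0 ≤ c) (hρ : 0 ≤ ρ)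
    (ht : 0 ≤ t) (hδ : 0 ≤ δ) :
    |gammaKernel c η ρ (t + δ) - gammaKernel c η ρ t| ≤
      c * |(t + δ) ^ (η - 1) - t ^ (η - 1)| + c * ρ * δ * t ^ (η - 1) := by
  have h2 : Real.exp (-ρ * (t + δ)) = Real.exp (-ρ * t) * Real.exp (-(ρ * δ)) := by
    rw [← Real.exp_add]; congr 1; ring
  have hfac : gammaKernel c η ρ (t + δ) - gammaKernel c η ρ t
      = c * ((t + δ) ^ (η - 1) - t ^ (η - 1)) * Real.exp (-ρ * (t + δ))
        + c * t ^ (η - 1) * (Real.exp (-ρ * t) * (Real.exp (-(ρ * δ)) - 1)) := by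
    unfold gammaKernel; rw [h2]; ring
  have e1 : Real.exp (-ρ * (t + δ)) ≤ 1 := Real.exp_le_one_iff.2 (by nlinarith)
  have e2 : Real.exp (-ρ * t) ≤ 1 := Real.exp_le_one_iff.2 (by nlinarith)
  have e3 : |Real.exp (-(ρ * δ)) - 1| ≤ ρ * δ := by
    rw [abs_of_nonpos (by linarith [Real.exp_le_one_iff.2 (neg_nonpos.2 (mul_nonneg hρ hδ))])]
    linarith [Real.add_one_le_exp (-(ρ * δ))]
  have hρδ := mul_nonneg hρ hδ
  rw [hfac]
  refine (abs_add_le _ _).trans (add_le_add ?_ ?_)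
  · rw [abs_mul, abs_mul, abs_of_nonneg hc, Real.abs_exp]
    exact mul_le_of_le_one_right (by positivity) e1
  · have hp : 0 ≤ c * t ^ (η - 1) := by positivity
    rw [abs_mul, abs_of_nonneg hp, abs_mul, Real.abs_exp]
    calc c * t ^ (η - 1) * (Real.exp (-ρ * t) * |Real.exp (-(ρ * δ)) - 1|)
        ≤ c * t ^ (η - 1) * (1 * (ρ * δ)) := by gcongr
      _ = _ := by ring

theorem gammaKernel_le {c ρ t : ℝ} (η : ℝ) (hc : 0 ≤ c) (hρ : 0 ≤ ρ) (ht : 0 ≤ t) :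
    gammaKernel c η ρ t ≤ c * t ^ (η - 1) := by
  unfold gammaKernel
  exact mul_le_of_le_one_right (by positivity) (Real.exp_le_one_iff.2 (by nlinarith))

theorem integral_rpow_sub_one {η : ℝ} (hη : 0 < η) (x y : ℝ) :
    ∫ t in x..y, t ^ (η - 1) = (y ^ η - x ^ η) / η := by
  rw [integral_rpow (Or.inl (by linarith)), sub_add_cancel]

theorem intervalIntegrable_rpow_sub_one {η : ℝ} (hη : 0 < η) (x y : ℝ) :
    IntervalIntegrable (fun t : ℝ => t ^ (η - 1)) volume x y :=
  intervalIntegral.intervalIntegrable_rpow' (by linarith)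

theorem intervalIntegrable_add_rpow_sub_one {η : ℝ} (hη : 0 < η) (x y δ : ℝ) :
    IntervalIntegrable (fun t : ℝ => (t + δ) ^ (η - 1)) volume x y := by
  simpa using (intervalIntegrable_rpow_sub_one hη (x + δ) (y + δ)).comp_add_right δ

theorem Real.add_rpow_sub_rpow_le {η R δ : ℝ} (hη : 0 ≤ η) (hR : 1 ≤ R) (hδ : 0 ≤ δ)
    (hδ1 : δ ≤ 1) : (R + δ) ^ η - R ^ η ≤ η * Real.exp η * δ * R ^ η := by
  have hR0 : 0 < R := by linarith
  have h := Real.abs_mul_log_one_add_div_sub_le η 0 le_rfl hR hδ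
  simp only [zero_mul, sub_zero, add_zero, abs_of_nonneg hη] at h
  have hd : 0 < 1 + δ / R := by positivity
  have h1 : R + δ = R * (1 + δ / R) := by field_simp
  rw [h1, Real.mul_rpow hR0.le hd.le, Real.rpow_def_of_pos hd]
  have h2 : Real.exp (Real.log (1 + δ / R) * η) - 1 ≤ η * Real.exp η * δ := by
    rw [mul_comm (Real.log _)]
    calc _ ≤ |η * Real.log (1 + δ / R)| * Real.exp |η * Real.log (1 + δ / R)| :=
          (le_abs_self _).trans (Real.abs_exp_sub_one_le_abs_mul_exp_abs _)
      _ ≤ (η * δ) * Real.exp η := by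
          gcongr
          exact h.trans (mul_le_of_le_one_right hη hδ1)
      _ = _ := by ring
  have h3 : 0 ≤ R ^ η := by positivity
  nlinarith

theorem integral_abs_add_rpow_sub_rpow_le {η R δ : ℝ} (hη : 0 < η) (hR : 1 ≤ R) (hδ : 0 < δ)
    (hδ1 : δ ≤ 1) :
    ∫ t in (0:ℝ)..R, |(t + δ) ^ (η - 1) - t ^ (η - 1)| ≤
      (η * Real.exp η * δ * R ^ η + δ ^ η) / η := by
  have hR0 : 0 ≤ R := by linarith
  have hkey : ∫ t in (0:ℝ)..R, |(t + δ) ^ (η - 1) - t ^ (η - 1)|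
      = |∫ t in (0:ℝ)..R, ((t + δ) ^ (η - 1) - t ^ (η - 1))| := by
    rcases le_total 1 η with h | h
    · have hs : ∀ t ∈ Set.Ioo (0:ℝ) R, 0 ≤ (t + δ) ^ (η - 1) - t ^ (η - 1) := fun t ht =>
        sub_nonneg.2 (Real.rpow_le_rpow ht.1.le (by linarith) (by linarith))
      have e : ∫ t in (0:ℝ)..R, |(t + δ) ^ (η - 1) - t ^ (η - 1)|
          = ∫ t in (0:ℝ)..R, ((t + δ) ^ (η - 1) - t ^ (η - 1)) := by
        simp only [intervalIntegral.integral_of_le hR0, integral_Ioc_eq_integral_Ioo]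
        exact setIntegral_congr_fun measurableSet_Ioo fun t ht => abs_of_nonneg (hs t ht)
      rw [← e, abs_of_nonneg]
      exact intervalIntegral.integral_nonneg hR0 fun _ _ => abs_nonneg _
    · have hs : ∀ t ∈ Set.Ioo (0:ℝ) R, (t + δ) ^ (η - 1) - t ^ (η - 1) ≤ 0 := fun t ht =>
        sub_nonpos.2 (Real.rpow_le_rpow_of_nonpos ht.1 (by linarith) (by linarith))
      have e : ∫ t in (0:ℝ)..R, |(t + δ) ^ (η - 1) - t ^ (η - 1)|
          = -∫ t in (0:ℝ)..R, ((t + δ) ^ (η - 1) - t ^ (η - 1)) := by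
        rw [← intervalIntegral.integral_neg]
        simp only [intervalIntegral.integral_of_le hR0, integral_Ioc_eq_integral_Ioo]
        exact setIntegral_congr_fun measurableSet_Ioo fun t ht => abs_of_nonpos (hs t ht)
      rw [← abs_neg, ← e, abs_of_nonneg]
      exact intervalIntegral.integral_nonneg hR0 fun _ _ => abs_nonneg _
  rw [hkey, intervalIntegral.integral_sub (intervalIntegrable_add_rpow_sub_one hη _ _ _)
    (intervalIntegrable_rpow_sub_one hη _ _),
    intervalIntegral.integral_comp_add_right (fun t : ℝ => t ^ (η - 1)),
    integral_rpow_sub_one hη, integral_rpow_sub_one hη, Real.zero_rpow hη.ne', zero_add, sub_zero,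
    ← sub_div, abs_div, abs_of_pos hη]
  have h1 := Real.add_rpow_sub_rpow_le hη.le hR hδ.le hδ1
  have h2 : R ^ η ≤ (R + δ) ^ η := Real.rpow_le_rpow hR0 (by linarith) hη.le
  have h3 : 0 ≤ δ ^ η := by positivity
  gcongr
  rw [abs_le]
  constructor <;> linarith

theorem integral_gammaKernel_modulus_le {c η ρ R S δ : ℝ} (hc : 0 ≤ c) (hη : 0 < η)
    (hρ : 0 ≤ ρ) (hR : 1 ≤ R) (hRS : R ≤ S) (hδ : 0 < δ) (hδ1 : δ ≤ 1) :
    ∫ t in (0:ℝ)..R, (c * |(t + δ) ^ (η - 1) - t ^ (η - 1)| + c * ρ * δ * t ^ (η - 1)) ≤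
      c * ((η * Real.exp η * S ^ η + 1) / η + ρ * (S ^ η / η)) * δ ^ min η 1 := by
  have hR0 : 0 ≤ R := by linarith
  have hRS' : R ^ η ≤ S ^ η := Real.rpow_le_rpow hR0 hRS hη.le
  have hS : 0 ≤ S ^ η := Real.rpow_nonneg (hR0.trans hRS) _
  have hδη : δ ^ η ≤ δ ^ min η 1 := Real.rpow_le_rpow_of_exponent_ge hδ hδ1 (min_le_left _ _)
  have hδm : δ ≤ δ ^ min η 1 := by
    simpa using Real.rpow_le_rpow_of_exponent_ge hδ hδ1 (min_le_right η 1)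
  have hdiff := ((intervalIntegrable_add_rpow_sub_one hη 0 R δ).sub
    (intervalIntegrable_rpow_sub_one hη 0 R)).abs
  rw [intervalIntegral.integral_add (hdiff.const_mul c)
    ((intervalIntegrable_rpow_sub_one hη 0 R).const_mul _),
    intervalIntegral.integral_const_mul, intervalIntegral.integral_const_mul,
    integral_rpow_sub_one hη, Real.zero_rpow hη.ne', sub_zero]
  have h := integral_abs_add_rpow_sub_rpow_le hη hR hδ hδ1
  calc _ ≤ c * ((η * Real.exp η * δ * R ^ η + δ ^ η) / η) + c * ρ * δ * (R ^ η / η) := by gcongr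
    _ ≤ c * ((η * Real.exp η * δ ^ min η 1 * S ^ η + δ ^ min η 1) / η)
        + c * ρ * δ ^ min η 1 * (S ^ η / η) := by gcongr
    _ = _ := by ring

theorem abs_skewTerm_add_sub_le {c η ρ T L M Astar : ℝ} {a : ℝ → ℝ} (hc : 0 < c) (hη : 0 < η)
    (hρ : 0 < ρ) (hL : 1 ≤ L) (hM : ∀ s ∈ Set.Icc (-L) T, |a s| ≤ M)
    (hint : ∀ u ∈ Set.Icc (0:ℝ) T,
      IntegrableOn (fun s => gammaKernel c η ρ (u - s) * a s) (Set.Iio u))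
    (hAstar : ∀ u ∈ Set.Icc (0:ℝ) T,
      (∫ s in Set.Iio u, gammaKernel c η ρ (u - s) * |a s|) ≤ Astar)
    {u δ : ℝ} (hu : 0 ≤ u) (huT : u + δ ≤ T) (hδ : 0 < δ) (hδ1 : δ ≤ 1) :
    |skewTerm c η ρ a (u + δ) - skewTerm c η ρ a u| ≤
      ((|η - 1| + ρ) * Real.exp (|η - 1| + ρ) * Astar
        + M * (c * ((η * Real.exp η * (T + L) ^ η + 1) / η + ρ * ((T + L) ^ η / η)))
        + M * (c / η)) * δ ^ min η 1 := by
  have huT' : u ∈ Set.Icc (0:ℝ) T := ⟨hu, by linarith⟩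
  have hvT : u + δ ∈ Set.Icc (0:ℝ) T := ⟨by linarith, huT⟩
  have hM0 : 0 ≤ M := (abs_nonneg _).trans (hM 0 ⟨by linarith, by linarith⟩)
  have hδη : δ ^ η ≤ δ ^ min η 1 := Real.rpow_le_rpow_of_exponent_ge hδ hδ1 (min_le_left _ _)
  have hδm : δ ≤ δ ^ min η 1 := by
    simpa using Real.rpow_le_rpow_of_exponent_ge hδ hδ1 (min_le_right η 1)
  have hFu := hint u huT'
  have hFv := hint _ hvT
  have habs : ∀ s ∈ Set.Iio u, |gammaKernel c η ρ (u - s) * a s|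
      = gammaKernel c η ρ (u - s) * |a s| := fun s hs => by
    rw [abs_mul, abs_of_nonneg (gammaKernel_nonneg η ρ hc.le (sub_nonneg.2 (le_of_lt hs)))]
  have hFu_abs : IntegrableOn (fun s => gammaKernel c η ρ (u - s) * |a s|) (Set.Iio u) :=
    (integrableOn_congr_fun habs measurableSet_Iio).1 hFu.abs
  have hA0 : 0 ≤ ∫ s in Set.Iio u, gammaKernel c η ρ (u - s) * |a s| :=
    setIntegral_nonneg measurableSet_Iio fun s hs =>
      mul_nonneg (gammaKernel_nonneg η ρ hc.le (sub_nonneg.2 (le_of_lt hs))) (abs_nonneg _)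
  set G : ℝ → ℝ := fun s => gammaKernel c η ρ (u + δ - s) * a s - gammaKernel c η ρ (u - s) * a s
    with hG
  have hsub : Set.Iio u ⊆ Set.Iio (u + δ) := Set.Iio_subset_Iio (by linarith)
  have hGint : IntegrableOn G (Set.Iio u) := (hFv.mono_set hsub).sub hFu
  have hGabs : ∀ s, |G s| =
      |gammaKernel c η ρ ((u - s) + δ) - gammaKernel c η ρ (u - s)| * |a s| := fun s => by
    rw [← abs_mul, hG]
    congr 1
    beta_reduce
    rw [show u + δ - s = (u - s) + δ by ring]
    ring
  have hdecomp : skewTerm c η ρ a (u + δ) - skewTerm c η ρ a u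
      = (∫ s in Set.Iio u, G s) +
        ∫ s in Set.Ico u (u + δ), gammaKernel c η ρ (u + δ - s) * a s := by
    unfold skewTerm
    rw [integral_sub (hFv.mono_set hsub) hFu,
      ← Set.Iio_union_Ico_eq_Iio (show u ≤ u + δ by linarith),
      setIntegral_union ((Set.Iio_disjoint_Ici le_rfl).mono_right Set.Ico_subset_Ici_self)
        measurableSet_Ico
        (hFv.mono_set hsub) (hFv.mono_set fun s hs => hs.2)]
    ring
  have hLu : -L ≤ u := by linarith
  have hrecent : |∫ s in Set.Ico u (u + δ), gammaKernel c η ρ (u + δ - s) * a s|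
      ≤ M * (c / η) * δ ^ min η 1 := by
    have hI : IntervalIntegrable (fun s : ℝ => M * (c * (u + δ - s) ^ (η - 1))) volume u (u + δ) := by
      have := (intervalIntegrable_rpow_sub_one hη δ 0).comp_sub_left (u + δ)
      simp only [add_sub_cancel_right, sub_zero] at this
      exact (this.const_mul c).const_mul M
    calc _ ≤ ∫ s in Set.Ico u (u + δ), |gammaKernel c η ρ (u + δ - s) * a s| :=
          abs_integral_le_integral_abs
      _ ≤ ∫ s in Set.Ico u (u + δ), M * (c * (u + δ - s) ^ (η - 1)) := by
          refine setIntegral_mono_on (hFv.mono_set fun s hs => hs.2).abs ?_ measurableSet_Ico ?_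
          · rw [integrableOn_Ico_iff_integrableOn_Ioo, ← integrableOn_Ioc_iff_integrableOn_Ioo]
            exact (intervalIntegrable_iff_integrableOn_Ioc_of_le (by linarith)).1 hI
          · intro s hs
            have h0 : 0 ≤ u + δ - s := by linarith [hs.2]
            rw [abs_mul, abs_of_nonneg (gammaKernel_nonneg η ρ hc.le h0), mul_comm]
            exact mul_le_mul (hM s ⟨by linarith [hs.1], by linarith [hs.2]⟩)
              (gammaKernel_le η hc.le hρ.le h0) (gammaKernel_nonneg η ρ hc.le h0) hM0
      _ = M * (c * (δ ^ η / η)) := by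
          rw [integral_Ico_eq_integral_Ioo, ← integral_Ioc_eq_integral_Ioo,
            ← intervalIntegral.integral_of_le (by linarith),
            intervalIntegral.integral_const_mul, intervalIntegral.integral_const_mul,
            intervalIntegral.integral_comp_sub_left (fun t : ℝ => t ^ (η - 1)),
            integral_rpow_sub_one hη, sub_self, Real.zero_rpow hη.ne', sub_zero,
            add_sub_cancel_left]
      _ = M * (c / η) * δ ^ η := by ring
      _ ≤ _ := by gcongr
  have hfar : ∫ s in Set.Iio (-L), |G s|
      ≤ (|η - 1| + ρ) * Real.exp (|η - 1| + ρ) * Astar * δ ^ min η 1 := by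
    have hLsub : Set.Iio (-L) ⊆ Set.Iio u := Set.Iio_subset_Iio hLu
    calc _ ≤ ∫ s in Set.Iio (-L), ((|η - 1| + ρ) * Real.exp (|η - 1| + ρ)) * δ *
            (gammaKernel c η ρ (u - s) * |a s|) := by
          refine setIntegral_mono_on (hGint.mono_set hLsub).abs
            ((hFu_abs.mono_set hLsub).const_mul _) measurableSet_Iio fun s hs => ?_
          rw [hGabs, ← mul_assoc]
          have hs' : s < -L := hs
          exact mul_le_mul_of_nonneg_right (abs_gammaKernel_add_sub_le_of_one_le η hc.le hρ.le
            (by linarith) hδ.le hδ1) (abs_nonneg _)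
      _ = ((|η - 1| + ρ) * Real.exp (|η - 1| + ρ)) * δ *
            ∫ s in Set.Iio (-L), gammaKernel c η ρ (u - s) * |a s| := integral_const_mul _ _
      _ ≤ ((|η - 1| + ρ) * Real.exp (|η - 1| + ρ)) * δ * Astar := by
          gcongr
          refine (setIntegral_mono_set hFu_abs ?_ hLsub.eventuallyLE).trans (hAstar u huT')
          filter_upwards [ae_restrict_mem measurableSet_Iio] with s hs
          rw [← habs s hs]
          exact abs_nonneg _
      _ = (|η - 1| + ρ) * Real.exp (|η - 1| + ρ) * Astar * δ := by ring
      _ ≤ _ := by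
          have : 0 ≤ Astar := hA0.trans (hAstar u huT')
          gcongr
  have hmid : ∫ s in Set.Ico (-L) u, |G s|
      ≤ M * (c * ((η * Real.exp η * (T + L) ^ η + 1) / η + ρ * ((T + L) ^ η / η)))
        * δ ^ min η 1 := by
    set h : ℝ → ℝ := fun t => c * |(t + δ) ^ (η - 1) - t ^ (η - 1)| + c * ρ * δ * t ^ (η - 1)
      with hh
    have hhint : IntervalIntegrable h volume (u + L) 0 :=
      (((intervalIntegrable_add_rpow_sub_one hη _ _ δ).sub
        (intervalIntegrable_rpow_sub_one hη _ _)).abs.const_mul c).add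
        ((intervalIntegrable_rpow_sub_one hη _ _).const_mul _)
    have hI : IntervalIntegrable (fun s : ℝ => M * h (u - s)) volume (-L) u := by
      have := hhint.comp_sub_left u
      simp only [sub_add_cancel_left, sub_zero] at this
      exact this.const_mul M
    calc _ ≤ ∫ s in Set.Ico (-L) u, M * h (u - s) := by
          refine setIntegral_mono_on (hGint.mono_set fun s hs => hs.2).abs ?_ measurableSet_Ico ?_
          · rw [integrableOn_Ico_iff_integrableOn_Ioo, ← integrableOn_Ioc_iff_integrableOn_Ioo]
            exact (intervalIntegrable_iff_integrableOn_Ioc_of_le hLu).1 hI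
          · intro s hs
            rw [hGabs, mul_comm]
            exact mul_le_mul (hM s ⟨hs.1, by linarith [hs.2]⟩)
              (abs_gammaKernel_add_sub_le η hc.le hρ.le (by linarith [hs.2]) hδ.le)
              (abs_nonneg _) hM0
      _ = M * ∫ t in (0:ℝ)..(u + L), h t := by
          rw [integral_Ico_eq_integral_Ioo, ← integral_Ioc_eq_integral_Ioo,
            ← intervalIntegral.integral_of_le hLu,
            intervalIntegral.integral_const_mul,
            intervalIntegral.integral_comp_sub_left h, sub_self, sub_neg_eq_add]
      _ ≤ M * (c * ((η * Real.exp η * (T + L) ^ η + 1) / η + ρ * ((T + L) ^ η / η))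
            * δ ^ min η 1) := by
          gcongr
          exact integral_gammaKernel_modulus_le hc.le hη hρ.le (by linarith) (by linarith) hδ hδ1
      _ = _ := by ring
  have hpast : |∫ s in Set.Iio u, G s|
      ≤ (∫ s in Set.Iio (-L), |G s|) + ∫ s in Set.Ico (-L) u, |G s| := by
    refine abs_integral_le_integral_abs.trans_eq ?_
    rw [← Set.Iio_union_Ico_eq_Iio hLu,
      setIntegral_union ((Set.Iio_disjoint_Ici le_rfl).mono_right Set.Ico_subset_Ici_self)
        measurableSet_Ico
        (hGint.mono_set (Set.Iio_subset_Iio hLu)).abs (hGint.mono_set fun s hs => hs.2).abs]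
  rw [hdecomp]
  refine (abs_add_le _ _).trans ?_
  linarith

theorem sum_increments_rpow_le {A : ℝ → ℝ} {T C m p : ℝ} (hT : 0 ≤ T) (hC : 0 ≤ C) (hp : 0 ≤ p)
    {δ : ℝ} (hδ : 0 < δ)
    (hA : ∀ u, 0 ≤ u → u + δ ≤ T → |A (u + δ) - A u| ≤ C * δ ^ m) :
    ∑ j ∈ Finset.Icc 1 ⌊T / δ⌋₊, |A ((j:ℝ) * δ) - A (((j:ℝ) - 1) * δ)| ^ p ≤
      T * C ^ p * δ ^ (p * m - 1) := by
  have hterm : ∀ j ∈ Finset.Icc 1 ⌊T / δ⌋₊,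
      |A ((j:ℝ) * δ) - A (((j:ℝ) - 1) * δ)| ^ p ≤ C ^ p * δ ^ (p * m) := by
    intro j hj
    obtain ⟨h1, h2⟩ := Finset.mem_Icc.1 hj
    have h1' : (1:ℝ) ≤ j := by exact_mod_cast h1
    have h2' : (j:ℝ) * δ ≤ T :=
      (le_div_iff₀ hδ).1 ((Nat.cast_le.2 h2).trans (Nat.floor_le (by positivity)))
    have he : (j:ℝ) * δ = ((j:ℝ) - 1) * δ + δ := by ring
    have h := hA (((j:ℝ) - 1) * δ) (mul_nonneg (by linarith) hδ.le) (by linarith)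
    rw [← he] at h
    calc _ ≤ (C * δ ^ m) ^ p := Real.rpow_le_rpow (abs_nonneg _) h hp
      _ = C ^ p * δ ^ (p * m) := by
        rw [Real.mul_rpow hC (by positivity), ← Real.rpow_mul hδ.le, mul_comm m]
  calc _ ≤ ∑ _j ∈ Finset.Icc 1 ⌊T / δ⌋₊, C ^ p * δ ^ (p * m) := Finset.sum_le_sum hterm
    _ = (⌊T / δ⌋₊ : ℝ) * (C ^ p * δ ^ (p * m)) := by simp
    _ ≤ T / δ * (C ^ p * δ ^ (p * m)) := by
        gcongr
        exact Nat.floor_le (by positivity)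
    _ = T * C ^ p * δ ^ (p * m - 1) := by
        rw [Real.rpow_sub hδ, Real.rpow_one]
        ring

theorem skewTerm_power_variation_bound (c η ρ : ℝ) (hc : 0 < c) (hη : 0 < η) (hρ : 0 < ρ)
    (T : ℝ) (hT : 0 < T) (a : ℝ → ℝ) (ha_meas : Measurable a)
    (M : ℝ) (hM : ∀ s ∈ Set.Icc (-(max ((η - 1) / ρ) 1)) T, |a s| ≤ M)
    (hint : ∀ u ∈ Set.Icc (0:ℝ) T,
      IntegrableOn (fun s => gammaKernel c η ρ (u - s) * a s) (Set.Iio u))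
    (Astar : ℝ) (hAstar : ∀ u ∈ Set.Icc (0:ℝ) T,
      (∫ s in Set.Iio u, gammaKernel c η ρ (u - s) * |a s|) ≤ Astar) :
    ∀ p : ℝ, 1 ≤ p → ∃ K : ℝ, 0 < K ∧ ∀ δ ∈ Set.Ioo (0:ℝ) 1,
      (∑ j ∈ Finset.Icc 1 ⌊T/δ⌋₊,
          |skewTerm c η ρ a ((j:ℝ) * δ) - skewTerm c η ρ a (((j:ℝ) - 1) * δ)| ^ p) ≤
        K * δ ^ (p * min η 1 - 1) := by
  intro p hp
  set L := max ((η - 1) / ρ) 1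
  have hL : 1 ≤ L := le_max_right _ _
  obtain ⟨C, hC⟩ : ∃ C, C = (|η - 1| + ρ) * Real.exp (|η - 1| + ρ) * Astar
        + M * (c * ((η * Real.exp η * (T + L) ^ η + 1) / η + ρ * ((T + L) ^ η / η)))
        + M * (c / η) := ⟨_, rfl⟩
  have hCpos : 0 < |C| + 1 := by positivity
  refine ⟨T * (|C| + 1) ^ p, by positivity, fun δ hδ => ?_⟩
  refine sum_increments_rpow_le hT.le hCpos.le (by linarith) hδ.1 fun u hu huT => ?_
  have h := abs_skewTerm_add_sub_le hc hη hρ hL hM hint hAstar hu huT hδ.1 hδ.2.le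
  rw [← hC] at h
  have hpos : 0 ≤ δ ^ min η 1 := Real.rpow_nonneg hδ.1.le _
  exact h.trans (mul_le_mul_of_nonneg_right (by linarith [le_abs_self C]) hpos)
end
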